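/- Let s > 3/4 be a real number. For n ∈ ℤ³ set a(n) = (1+|n|²)^{-(s+1)} and a'(n) = (1+|n|²)^{-s}, and set b(0) = 1, b(n) = (|n|² + |n|^{2s+2})^{-1} for n ≠ 0, and b'(n) = (1+|n|^{2s})^{-1}. Let μ be the countable product probability measure on ℝ^{ℤ³ ⊕ ℤ³} whose factor at index (n, first copy) is the centered one-dimensional Gaussian measure of variance a(n) and whose factor at (n, second copy) is the centered Gaussian of variance a'(n), and let ν be the analogous product measure with variances b(n) and b'(n). Then μ and ν are mutually absolutely continuous. -/

import Mathlib

open MeasureTheory ProbabilityTheory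
open scoped ENNReal NNReal BigOperators

noncomputable section

/-- The square of the Euclidean norm of a lattice point `n ∈ ℤ³`, as a real number. -/
def nsqR (n : Fin 3 → ℤ) : ℝ := ∑ i, ((n i : ℝ))^2

lemma core_bound {Ω : Type*} [MeasurableSpace Ω] (μ ν : Measure Ω) [IsProbabilityMeasure μ]
    [IsProbabilityMeasure ν] (Y : Ω → ℝ) (hY : Measurable Y) (hYi : Integrable Y μ) (K : ℝ)
    (hK : ∫ x, Y x ∂μ ≤ K)
    (hν : ν = μ.withDensity (fun x => ENNReal.ofReal (Real.exp (-Y x))))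
    (A : Set Ω) (hA : MeasurableSet A) (L : ℝ) (hL : 1 < L) :
    μ.real A ≤ Real.exp L * ν.real A + K / (L - 1) := by
  have hlin : ∫⁻ x, ENNReal.ofReal (Real.exp (-Y x)) ∂μ = 1 := by
    have h : ν Set.univ = 1 := measure_univ
    rw [hν, withDensity_apply _ MeasurableSet.univ] at h
    simpa using h
  have hEi : Integrable (fun x => Real.exp (-Y x)) μ := by
    refine ⟨(by fun_prop), ?_⟩
    rw [hasFiniteIntegral_iff_ofReal (Filter.Eventually.of_forall fun x => (Real.exp_pos _).le), hlin]
    simp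
  have hE1 : ∫ x, Real.exp (-Y x) ∂μ = 1 := by
    rw [integral_eq_lintegral_of_nonneg_ae (Filter.Eventually.of_forall fun x => (Real.exp_pos _).le)
      (by fun_prop), hlin]
    simp
  have hm := mul_meas_ge_le_integral_of_nonneg (μ := μ)
    (f := fun x => Y x + Real.exp (-Y x) - 1)
    (Filter.Eventually.of_forall fun x => by
      have := Real.add_one_le_exp (-Y x)
      simp only [Pi.zero_apply]; linarith)
    ((hYi.add hEi).sub (integrable_const 1)) (L - 1)
  have hint : ∫ x, (Y x + Real.exp (-Y x) - 1) ∂μ = ∫ x, Y x ∂μ := by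
    have e1 := integral_sub (hYi.add hEi) (integrable_const (1:ℝ))
    have e2 := integral_add hYi hEi
    simp only [Pi.add_apply] at e1 e2
    rw [e1, e2, hE1]
    simp
  rw [hint] at hm
  have h1 : μ.real {x | L - 1 ≤ Y x + Real.exp (-Y x) - 1} ≤ K / (L - 1) := by
    rw [le_div_iff₀ (by linarith)]
    linarith
  have h2 : μ.real (A ∩ {x | Y x ≤ L}) ≤ Real.exp L * ν.real A := by
    have hB : MeasurableSet (A ∩ {x | Y x ≤ L}) := hA.inter (measurableSet_le hY measurable_const)
    have h3 : ENNReal.ofReal (Real.exp (-L)) * μ (A ∩ {x | Y x ≤ L}) ≤ ν A := by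
      calc _ = ∫⁻ x in A ∩ {x | Y x ≤ L}, ENNReal.ofReal (Real.exp (-L)) ∂μ := by simp
        _ ≤ ∫⁻ x in A ∩ {x | Y x ≤ L}, ENNReal.ofReal (Real.exp (-Y x)) ∂μ := by
          refine setLIntegral_mono (by fun_prop) ?_
          intro x hx
          have := hx.2
          simp only [Set.mem_ofPred_eq] at this
          gcongr
        _ = ν (A ∩ {x | Y x ≤ L}) := by rw [hν, withDensity_apply _ hB]
        _ ≤ ν A := measure_mono Set.inter_subset_left
    have h4 := ENNReal.toReal_mono (measure_ne_top ν A) h3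
    rw [ENNReal.toReal_mul, ENNReal.toReal_ofReal (Real.exp_pos _).le] at h4
    change Real.exp (-L) * μ.real _ ≤ ν.real A at h4
    calc μ.real (A ∩ {x | Y x ≤ L}) = Real.exp L * (Real.exp (-L) * μ.real (A ∩ {x | Y x ≤ L})) := by
          rw [← mul_assoc, ← Real.exp_add]; simp
      _ ≤ _ := by gcongr
  calc μ.real A ≤ μ.real ((A ∩ {x | Y x ≤ L}) ∪ {x | L - 1 ≤ Y x + Real.exp (-Y x) - 1}) := by
        refine measureReal_mono ?_
        intro x hx
        by_cases h : Y x ≤ L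
        · exact Or.inl ⟨hx, h⟩
        · right
          have := Real.exp_pos (-Y x)
          simp only [Set.mem_ofPred_eq]
          linarith
    _ ≤ _ := measureReal_union_le _ _
    _ ≤ _ := add_le_add h2 h1

lemma pi_withDensity' {ι : Type*} [Fintype ι] (m m' : ι → Measure ℝ)
    [∀ i, IsProbabilityMeasure (m i)] [∀ i, IsProbabilityMeasure (m' i)]
    (f : ι → ℝ → ℝ≥0∞) (hf : ∀ i, Measurable (f i)) (hm : ∀ i, m' i = (m i).withDensity (f i)) :
    Measure.pi m' = (Measure.pi m).withDensity (fun x => ∏ i, f i (x i)) := by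
  refine Measure.pi_eq fun t ht => ?_
  rw [withDensity_apply _ (MeasurableSet.univ_pi ht), ← lintegral_indicator (MeasurableSet.univ_pi ht)]
  have hmeas : ∀ i, Measurable ((t i).indicator (f i)) := fun i => (hf i).indicator (ht i)
  have h1 : (Set.univ.pi t).indicator (fun x => ∏ i, f i (x i))
      = fun x => ∏ i, (t i).indicator (f i) (x i) := by
    ext x
    by_cases hx : x ∈ Set.univ.pi t
    · rw [Set.indicator_of_mem hx]
      refine Finset.prod_congr rfl fun i _ => ?_
      rw [Set.indicator_of_mem (hx i trivial)]
    · rw [Set.indicator_of_notMem hx]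
      simp only [Set.mem_pi, Set.mem_univ, forall_const, not_forall] at hx
      obtain ⟨i, hi⟩ := hx
      symm
      exact Finset.prod_eq_zero (Finset.mem_univ i) (Set.indicator_of_notMem hi _)
  have h2 := lintegral_prod_eq_prod_lintegral_of_indepFun (μ := Measure.pi m) Finset.univ
    (fun i (x : ι → ℝ) => (t i).indicator (f i) (x i))
    (iIndepFun_pi fun i => (hmeas i).aemeasurable)
    (fun i => (hmeas i).comp (measurable_pi_apply i))
  rw [h1, h2]
  refine Finset.prod_congr rfl fun i _ => ?_
  rw [hm, withDensity_apply _ (ht i), ← lintegral_indicator (ht i)]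
  exact (measurePreserving_eval m i).lintegral_comp (hmeas i)

/-- log density of N(0,a) w.r.t. N(0,b) -/
def gl (a b : ℝ≥0) (x : ℝ) : ℝ :=
  (1/2) * Real.log (b / a) - x ^ 2 / 2 * (1 / a - 1 / b)

lemma gl_meas (a b : ℝ≥0) : Measurable (gl a b) := by unfold gl; fun_prop

lemma gl_density (a b : ℝ≥0) (ha : 0 < a) (hb : 0 < b) :
    gaussianReal 0 b = (gaussianReal 0 a).withDensity
      (fun x => ENNReal.ofReal (Real.exp (- gl a b x))) := by
  have hm := gl_meas a b
  rw [gaussianReal_of_var_ne_zero 0 ha.ne', gaussianReal_of_var_ne_zero 0 hb.ne',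
    ← withDensity_mul _ (measurable_gaussianPDF 0 a) (by fun_prop)]
  congr 1
  ext x
  have ha' : (0:ℝ) < a := ha
  have hb' : (0:ℝ) < b := hb
  simp only [Pi.mul_apply, gaussianPDF]
  rw [← ENNReal.ofReal_mul (gaussianPDFReal_nonneg _ _ _)]
  congr 1
  simp only [gaussianPDFReal, gl]
  have e1 : -((1/2) * Real.log ((b:ℝ) / a) - x ^ 2 / 2 * (1 / a - 1 / b))
      = -(Real.log ((b:ℝ) / a) / 2) + x ^ 2 / 2 * (1 / a - 1 / b) := by ring
  rw [e1, Real.exp_add, Real.exp_neg, Real.exp_half, Real.exp_log (by positivity)]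
  have e2 : Real.exp (-(x - 0) ^ 2 / (2 * b)) = Real.exp (-(x - 0) ^ 2 / (2 * a)) *
      Real.exp (x ^ 2 / 2 * (1 / a - 1 / b)) := by
    rw [← Real.exp_add]; congr 1; field_simp; ring
  have e3 : √(2 * Real.pi * b) = √(2 * Real.pi * a) * √(b / a) := by
    rw [← Real.sqrt_mul (by positivity)]; congr 1; field_simp
  rw [e2, e3, mul_inv]
  ring

lemma sq_integrable (a : ℝ≥0) : Integrable (fun x : ℝ => x ^ 2) (gaussianReal 0 a) := by
  have := (memLp_id_gaussianReal (μ := 0) (v := a) 2)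
  exact this.integrable_sq

lemma sq_integral (a : ℝ≥0) : ∫ x, x ^ 2 ∂(gaussianReal 0 a) = a := by
  have h := variance_id_gaussianReal (μ := 0) (v := a)
  rw [variance_of_integral_eq_zero (by fun_prop) (by simp)] at h
  simpa using h

lemma gl_integrable (a b : ℝ≥0) : Integrable (gl a b) (gaussianReal 0 a) := by
  unfold gl
  exact (integrable_const _).sub (((sq_integrable a).div_const 2).mul_const _)

lemma gl_integral (a b : ℝ≥0) (ha : 0 < a) (hb : 0 < b) :
    ∫ x, gl a b x ∂(gaussianReal 0 a) ≤ ((b:ℝ) / a + a / b - 2) := by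
  have ha' : (0:ℝ) < a := ha
  have hb' : (0:ℝ) < b := hb
  have h0 : ∫ x, gl a b x ∂(gaussianReal 0 a)
      = (1/2) * Real.log (b / a) - a / 2 * (1 / a - 1 / b) := by
    unfold gl
    generalize (1/2) * Real.log ((b:ℝ) / a) = c
    generalize (1 / (a:ℝ) - 1 / b) = d
    rw [integral_sub (integrable_const _) (((sq_integrable a).div_const 2).mul_const _),
      integral_mul_const, integral_div, sq_integral]
    simp
  rw [h0]
  have h1 := Real.log_le_sub_one_of_pos (show (0:ℝ) < b / a by positivity)
  have h2 : (a:ℝ) / 2 * (1 / a - 1 / b) = 1/2 - (a / b) / 2 := by field_simp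
  have h3 : 0 ≤ (b:ℝ) / a + a / b - 2 := by
    have : (b:ℝ) / a + a / b - 2 = (a - b)^2 / (a * b) := by field_simp; ring
    rw [this]; positivity
  rw [h2]; linarith

lemma fin_bound {ι : Type*} [Fintype ι] (a b : ι → ℝ≥0) (ha : ∀ i, 0 < a i) (hb : ∀ i, 0 < b i)
    (K : ℝ) (hK : ∑ i, ((b i:ℝ) / a i + a i / b i - 2) ≤ K)
    (A : Set (ι → ℝ)) (hA : MeasurableSet A) (L : ℝ) (hL : 1 < L) :
    (Measure.pi fun i => gaussianReal 0 (a i)).real A ≤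
      Real.exp L * (Measure.pi fun i => gaussianReal 0 (b i)).real A + K / (L - 1) := by
  have hi : ∀ i, Integrable (fun x : ι → ℝ => gl (a i) (b i) (x i))
      (Measure.pi fun i => gaussianReal 0 (a i)) := fun i =>
    (measurePreserving_eval (fun i => gaussianReal 0 (a i)) i).integrable_comp_of_integrable
      (gl_integrable (a i) (b i))
  have hgm := fun i => gl_meas (a i) (b i)
  have hYm : Measurable (fun x : ι → ℝ => ∑ i, gl (a i) (b i) (x i)) :=
    Finset.measurable_fun_sum _ fun i _ => (hgm i).comp (measurable_pi_apply i)
  have hYi := integrable_finsetSum (μ := Measure.pi fun i => gaussianReal 0 (a i))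
    Finset.univ fun i _ => hi i
  refine core_bound (Measure.pi fun i => gaussianReal 0 (a i))
    (Measure.pi fun i => gaussianReal 0 (b i)) (fun x : ι → ℝ => ∑ i, gl (a i) (b i) (x i)) hYm
    hYi K ?_ ?_ A hA L hL
  · rw [integral_finsetSum _ fun i _ => hi i]
    refine le_trans (Finset.sum_le_sum fun i _ => ?_) hK
    have := integral_map (μ := Measure.pi fun i => gaussianReal 0 (a i))
      (measurable_pi_apply i).aemeasurable (f := gl (a i) (b i))
      (hgm i).aestronglyMeasurable
    rw [(measurePreserving_eval (fun i => gaussianReal 0 (a i)) i).map_eq] at this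
    rw [← this]
    exact gl_integral _ _ (ha i) (hb i)
  · rw [pi_withDensity' (fun i => gaussianReal 0 (a i)) (fun i => gaussianReal 0 (b i))
      (fun i x => ENNReal.ofReal (Real.exp (- gl (a i) (b i) x)))
      (fun i => (Real.measurable_exp.comp (hgm i).neg).ennreal_ofReal)
      (fun i => gl_density (a i) (b i) (ha i) (hb i))]
    congr 1
    ext x
    rw [← Finset.sum_neg_distrib, Real.exp_sum, ENNReal.ofReal_prod_of_nonneg]
    intro i _; positivity

lemma ac_of {ι : Type*} (a b : ι → ℝ≥0) (ha : ∀ i, 0 < a i) (hb : ∀ i, 0 < b i)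
    (hK : Summable fun i => ((b i:ℝ) / a i + a i / b i - 2))
    (μ ν : Measure (ι → ℝ)) [IsProbabilityMeasure μ] [IsProbabilityMeasure ν]
    (hμ : ∀ S : Finset ι, μ.map (fun x (i : S) => x i)
        = Measure.pi (fun i : S => gaussianReal 0 (a i)))
    (hν : ∀ S : Finset ι, ν.map (fun x (i : S) => x i)
        = Measure.pi (fun i : S => gaussianReal 0 (b i))) : μ ≪ ν := by
  have hnn : ∀ i, 0 ≤ ((b i:ℝ) / a i + a i / b i - 2) := fun i => by
    have ha' : (0:ℝ) < a i := ha i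
    have hb' : (0:ℝ) < b i := hb i
    have : (b i:ℝ) / a i + a i / b i - 2 = (a i - b i)^2 / (a i * b i) := by field_simp; ring
    rw [this]; positivity
  set K := ∑' i, ((b i:ℝ) / a i + a i / b i - 2) with hKdef
  have hcyl : ∀ A ∈ measurableCylinders (fun _ : ι => ℝ), ∀ L : ℝ, 1 < L →
      μ.real A ≤ Real.exp L * ν.real A + K / (L - 1) := by
    intro A hA L hL
    obtain ⟨S, T, hT, rfl⟩ := (mem_measurableCylinders A).1 hA
    have h := fin_bound (fun i : S => a i) (fun i : S => b i) (fun i => ha i) (fun i => hb i) K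
      (by
        rw [Finset.sum_coe_sort S (fun i => ((b i:ℝ) / a i + a i / b i - 2))]
        exact hK.sum_le_tsum _ fun i _ => hnn i) T hT L hL
    have hm : Measurable (fun (x : ι → ℝ) (i : S) => x i) := by fun_prop
    rw [← hμ S, ← hν S, map_measureReal_apply hm hT, map_measureReal_apply hm hT] at h
    exact h
  refine Measure.AbsolutelyContinuous.mk fun A hA hA0 => ?_
  have key : ∀ L : ℝ, 1 < L → μ.real A ≤ K / (L - 1) := by
    intro L hL
    refine le_of_forall_pos_le_add fun ε hε => ?_
    set δ := ε / (Real.exp L + 1) with hδ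
    have hδ0 : 0 < δ := by positivity
    obtain ⟨t, htC, ht⟩ := exists_measure_symmDiff_lt_of_generateFrom_isSetRing (μ := μ + ν)
      (C := measurableCylinders (fun _ : ι => ℝ)) isSetRing_measurableCylinders
      ⟨{Set.univ}, Set.countable_singleton _, by
        simpa using univ_mem_measurableCylinders (fun _ : ι => ℝ), by simp⟩
      generateFrom_measurableCylinders.symm hA (ENNReal.ofReal_pos.2 hδ0)
    rw [Measure.add_apply] at ht
    have hμt : μ.real (symmDiff t A) ≤ δ :=
      ENNReal.toReal_le_of_le_ofReal hδ0.le (le_trans le_self_add ht.le)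
    have hνt : ν.real (symmDiff t A) ≤ δ :=
      ENNReal.toReal_le_of_le_ofReal hδ0.le (le_trans le_add_self ht.le)
    have h1 : μ.real A ≤ μ.real t + δ := by
      refine le_trans (measureReal_mono (s₂ := t ∪ symmDiff t A) ?_) 
        (le_trans (measureReal_union_le _ _) (by linarith))
      intro x hx
      by_cases hxt : x ∈ t
      · exact Or.inl hxt
      · exact Or.inr (Or.inr ⟨hx, hxt⟩)
    have h2 : ν.real t ≤ δ := by
      have hA0' : ν.real A = 0 := by simp [Measure.real, hA0]
      refine le_trans (measureReal_mono (s₂ := A ∪ symmDiff t A) ?_) 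
        (le_trans (measureReal_union_le _ _) (by linarith))
      intro x hx
      by_cases hxt : x ∈ A
      · exact Or.inl hxt
      · exact Or.inr (Or.inl ⟨hx, hxt⟩)
    have h3 := hcyl t htC L hL
    have h4 : Real.exp L * ν.real t ≤ Real.exp L * δ := by gcongr
    have h5 : Real.exp L * δ + δ = ε := by rw [hδ]; field_simp
    linarith
  have hlim : Filter.Tendsto (fun L : ℝ => K / (L - 1)) Filter.atTop (nhds 0) :=
    Filter.Tendsto.div_atTop tendsto_const_nhds
      (Filter.tendsto_atTop_add_const_right _ _ Filter.tendsto_id)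
  have h0 : μ.real A ≤ 0 := ge_of_tendsto hlim
    (by filter_upwards [Filter.eventually_gt_atTop 1] with L hL using key L hL)
  have h1 : μ.real A = 0 := le_antisymm h0 measureReal_nonneg
  rwa [measureReal_eq_zero_iff] at h1


lemma summable_one_dim (r : ℝ) (hr : 1 / 2 < r) :
    Summable fun k : ℤ => (1 + (k:ℝ) ^ 2) ^ (-r) := by
  have h : Summable fun k : ℤ => |(k:ℝ)| ^ (-(2 * r)) :=
    Real.summable_abs_int_rpow (by linarith)
  refine (h.add (summable_of_ne_finset_zero (s := {0}) (f := fun k : ℤ => if k = 0 then (1:ℝ) else 0)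
    (by intro k hk; simp at hk; simp [hk]))).of_nonneg_of_le (fun k => by positivity) fun k => ?_
  by_cases hk : k = 0
  · subst hk; simp; positivity
  · have hk' : (0:ℝ) < |(k:ℝ)| := by positivity
    simp only [hk, if_false, add_zero]
    rw [show -(2 * r) = 2 * (-r) by ring, Real.rpow_mul hk'.le]
    refine Real.rpow_le_rpow_of_nonpos (by positivity) ?_ (by linarith)
    rw [Real.rpow_two, sq_abs]; linarith

lemma nsqR_nonneg (n : Fin 3 → ℤ) : 0 ≤ nsqR n := by unfold nsqR; positivity

lemma one_le_nsqR (n : Fin 3 → ℤ) (hn : n ≠ 0) : 1 ≤ nsqR n := by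
  obtain ⟨i, hi⟩ := Function.ne_iff.1 hn
  have h1 : (1:ℝ) ≤ (n i : ℝ) ^ 2 := by
    have : (1:ℤ) ≤ n i ^ 2 := by
      have : 0 < n i ^ 2 := by
        have : n i ≠ 0 := hi
        positivity
      omega
    exact_mod_cast this
  exact h1.trans (Finset.single_le_sum (f := fun i => (n i:ℝ)^2) (fun i _ => by positivity)
    (Finset.mem_univ i))

lemma summable_lattice (q : ℝ) (hq : 3 / 2 < q) :
    Summable fun n : Fin 3 → ℤ => (1 + nsqR n) ^ (-q) := by
  have h1 := summable_one_dim (q / 3) (by linarith)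
  set g : ℤ → ℝ := fun k => (1 + (k:ℝ) ^ 2) ^ (-(q/3)) with hg
  have hg0 : ∀ k, 0 ≤ g k := fun k => by simp only [hg]; positivity
  have hprod : Summable fun n : Fin 3 → ℤ => ∏ i, g (n i) := by
    refine summable_of_sum_le (c := (∑' k, g k) ^ 3) (fun n => Finset.prod_nonneg fun i _ => hg0 _) ?_
    intro u
    classical
    calc ∑ n ∈ u, ∏ i, g (n i)
        ≤ ∑ n ∈ Fintype.piFinset (fun i => u.image fun n => n i), ∏ i, g (n i) := by
          refine Finset.sum_le_sum_of_subset_of_nonneg ?_ fun n _ _ =>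
            Finset.prod_nonneg fun i _ => hg0 _
          intro n hn
          rw [Fintype.mem_piFinset]
          exact fun i => Finset.mem_image_of_mem _ hn
      _ = ∏ i, ∑ k ∈ u.image (fun n => n i), g k :=
          (Finset.prod_univ_sum _ _).symm
      _ ≤ ∏ _i : Fin 3, ∑' k, g k := Finset.prod_le_prod
          (fun i _ => Finset.sum_nonneg fun k _ => hg0 k)
          (fun i _ => h1.sum_le_tsum _ fun k _ => hg0 k)
      _ = _ := by simp
  refine hprod.of_nonneg_of_le (fun n => by have := nsqR_nonneg n; positivity) fun n => ?_
  have e : (1 + nsqR n) ^ (-q) = ∏ _i : Fin 3, (1 + nsqR n) ^ (-(q/3)) := by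
    have := nsqR_nonneg n
    rw [Finset.prod_const, Finset.card_univ, Fintype.card_fin, ← Real.rpow_natCast,
      ← Real.rpow_mul (by positivity)]
    congr 1; push_cast; ring
  rw [e]
  refine Finset.prod_le_prod (fun i _ => by have := nsqR_nonneg n; positivity) fun i _ => ?_
  refine Real.rpow_le_rpow_of_nonpos (by positivity) ?_ (by linarith)
  have := Finset.single_le_sum (f := fun i => (n i:ℝ)^2) (fun i _ => by positivity)
    (Finset.mem_univ i)
  unfold nsqR; linarith

lemma summable_lattice' (q : ℝ) (hq : 3 / 2 < q) (C : ℝ) (f : (Fin 3 → ℤ) → ℝ)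
    (hf0 : ∀ n, 0 ≤ f n) (hf : ∀ n, n ≠ 0 → f n ≤ C * nsqR n ^ (-q)) (h0 : f 0 = 0) (hC : 0 ≤ C) :
    Summable f := by
  refine ((summable_lattice q hq).mul_left (C * 2 ^ q)).of_nonneg_of_le hf0 fun n => ?_
  by_cases hn : n = 0
  · subst hn; rw [h0]; have := nsqR_nonneg 0; positivity
  · have h1 := one_le_nsqR n hn
    refine (hf n hn).trans ?_
    rw [mul_assoc]
    gcongr
    have h2 : (2 * nsqR n) ^ (-q) ≤ (1 + nsqR n) ^ (-q) :=
      Real.rpow_le_rpow_of_nonpos (by positivity) (by linarith) (by linarith)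
    rw [Real.mul_rpow (by norm_num) (by linarith)] at h2
    calc nsqR n ^ (-q) = 2 ^ q * (2 ^ (-q) * nsqR n ^ (-q)) := by
          rw [← mul_assoc, ← Real.rpow_add (by norm_num)]; simp
      _ ≤ _ := by gcongr

lemma pow_bound (p x : ℝ) (hp : 0 ≤ p) (hx0 : 0 ≤ x) (hx1 : x ≤ 1) :
    (1 + x) ^ p ≤ 1 + p * Real.exp p * x := by
  have h1 : (1 + x) ^ p ≤ Real.exp (p * x) := by
    rw [mul_comm, Real.exp_mul]
    exact Real.rpow_le_rpow (by linarith) (by linarith [Real.add_one_le_exp x]) hp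
  have h2 : Real.exp (p * x) * (1 - p * x) ≤ 1 := by
    have := Real.add_one_le_exp (-(p * x))
    calc Real.exp (p * x) * (1 - p * x) ≤ Real.exp (p * x) * Real.exp (-(p * x)) := by
          gcongr; linarith
      _ = 1 := by rw [← Real.exp_add]; simp
  have h3 : Real.exp (p * x) ≤ Real.exp p := by
    gcongr; nlinarith
  have h4 : p * x * Real.exp (p * x) ≤ p * x * Real.exp p := by gcongr
  nlinarith

/-- the ratio estimate, `α = N^p u`, `β = N^p w` with `u = (1+1/N)^p`, `w = 1 + N^{-s}` -/
lemma term_bound (s p N : ℝ) (hp : 0 ≤ p) (hs : 0 ≤ s) (hN : 1 ≤ N) (α β : ℝ)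
    (hα : α = (1 + N) ^ (-p)) (hβ : β = (N ^ p * (1 + N ^ (-s)))⁻¹) :
    β / α + α / β - 2 ≤ (2 * (p * Real.exp p) ^ 2 + 2) * N ^ (-(2 * min 1 s)) := by
  have hN0 : 0 < N := by linarith
  set u := (1 + N⁻¹) ^ p with hu
  set w := 1 + N ^ (-s) with hw
  set c := p * Real.exp p with hc
  have hc0 : 0 ≤ c := by positivity
  have hNp : 0 < N ^ p := by positivity
  have hu1 : 1 ≤ u := Real.one_le_rpow (by have : 0 < N⁻¹ := by positivity
                                           linarith) hp
  have hNs : 0 < N ^ (-s) := by positivity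
  have hw1 : 1 ≤ w := by linarith
  have hu2 : u ≤ 1 + c * N⁻¹ := pow_bound p N⁻¹ hp (by positivity) (inv_le_one_of_one_le₀ hN)
  have hα' : α = (N ^ p * u)⁻¹ := by
    rw [hα, Real.rpow_neg (by positivity), hu, ← Real.mul_rpow (by positivity) (by positivity)]
    congr 2; field_simp; ring
  set z := N ^ (-(min 1 s)) with hz
  have hz0 : 0 < z := by positivity
  have hz1 : N⁻¹ ≤ z := by
    rw [← Real.rpow_neg_one]
    exact Real.rpow_le_rpow_of_exponent_le hN (by linarith [min_le_left 1 s])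
  have hz2 : N ^ (-s) ≤ z := 
    Real.rpow_le_rpow_of_exponent_le hN (by linarith [min_le_right 1 s])
  have hzz : N ^ (-(2 * min 1 s)) = z ^ 2 := by
    rw [hz, ← Real.rpow_natCast, ← Real.rpow_mul hN0.le]; congr 1; push_cast; ring
  have hid : β / α + α / β - 2 = (u - w) ^ 2 / (u * w) := by
    rw [hα', hβ]
    have : 0 < u := by linarith
    have : 0 < w := by linarith
    field_simp
    ring
  rw [hid, hzz]
  have hcz : c * N⁻¹ ≤ c * z := by gcongr
  have h1 : u - w ≤ c * z := by linarith
  have h2 : -z ≤ u - w := by linarith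
  have hcz0 : 0 ≤ c * z := by positivity
  calc (u - w) ^ 2 / (u * w) ≤ (u - w) ^ 2 := div_le_self (sq_nonneg _) (by nlinarith)
    _ ≤ (c * z + z) ^ 2 := sq_le_sq' (by linarith) (by linarith)
    _ ≤ (2 * c ^ 2 + 2) * z ^ 2 := by nlinarith [sq_nonneg (c * z - z)]

lemma summable_sum_type {α β : Type*} (f : α ⊕ β → ℝ) (h1 : Summable fun x => f (Sum.inl x))
    (h2 : Summable fun x => f (Sum.inr x)) : Summable f :=
  Summable.sum (f := f) h1 h2

theorem gaussian_measures_equivalent (s : ℝ) (hs : 3/4 < s)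
    (a a' b b' : (Fin 3 → ℤ) → ℝ≥0)
    (ha : ∀ n, (a n : ℝ) = (1 + nsqR n) ^ (-(s + 1)))
    (ha' : ∀ n, (a' n : ℝ) = (1 + nsqR n) ^ (-s))
    (hb0 : b 0 = 1)
    (hb : ∀ n, n ≠ 0 → (b n : ℝ) = (nsqR n + nsqR n ^ (s + 1))⁻¹)
    (hb' : ∀ n, (b' n : ℝ) = (1 + nsqR n ^ s)⁻¹)
    (μ ν : Measure ((Fin 3 → ℤ) ⊕ (Fin 3 → ℤ) → ℝ))
    [IsProbabilityMeasure μ] [IsProbabilityMeasure ν]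
    (hμ : ∀ S : Finset ((Fin 3 → ℤ) ⊕ (Fin 3 → ℤ)),
      μ.map (fun x (i : S) => x i)
        = Measure.pi (fun i : S => gaussianReal 0 (Sum.elim a a' (i : (Fin 3 → ℤ) ⊕ (Fin 3 → ℤ)))))
    (hν : ∀ S : Finset ((Fin 3 → ℤ) ⊕ (Fin 3 → ℤ)),
      ν.map (fun x (i : S) => x i)
        = Measure.pi (fun i : S => gaussianReal 0 (Sum.elim b b' (i : (Fin 3 → ℤ) ⊕ (Fin 3 → ℤ))))) :
    μ ≪ ν ∧ ν ≪ μ := by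
  have hN := nsqR_nonneg
  have hz : nsqR 0 = 0 := by simp [nsqR]
  have pa : ∀ n, (0:ℝ) < a n := fun n => by rw [ha]; have := hN n; positivity
  have pa' : ∀ n, (0:ℝ) < a' n := fun n => by rw [ha']; have := hN n; positivity
  have pb' : ∀ n, (0:ℝ) < b' n := fun n => by rw [hb']; have := hN n; positivity
  have pb : ∀ n, (0:ℝ) < b n := fun n => by
    by_cases hn : n = 0
    · subst hn; simp [hb0]
    · rw [hb n hn]; have := one_le_nsqR n hn; positivity
  have hA : ∀ i, 0 < Sum.elim a a' i := by
    rintro (n | n)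
    · exact pa n
    · exact pa' n
  have hB : ∀ i, 0 < Sum.elim b b' i := by
    rintro (n | n)
    · exact pb n
    · exact pb' n
  have hnn : ∀ x y : ℝ, 0 < x → 0 < y → 0 ≤ y / x + x / y - 2 := fun x y hx hy => by
    have : y / x + x / y - 2 = (x - y)^2 / (x * y) := by field_simp; ring
    rw [this]; positivity
  have hq : 3 / 2 < 2 * min 1 s := by
    rcases min_cases 1 s with h | h <;> linarith
  have hS1 : Summable fun n => ((b n : ℝ) / a n + a n / b n - 2) := by
    refine summable_lattice' _ hq (2 * ((s+1) * Real.exp (s+1)) ^ 2 + 2) _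
      (fun n => hnn _ _ (pa n) (pb n)) (fun n hn => ?_) ?_ (by positivity)
    · have h1 := one_le_nsqR n hn
      refine term_bound s (s+1) (nsqR n) (by linarith) (by linarith) h1 _ _ (ha n) ?_
      rw [hb n hn, mul_add, ← Real.rpow_add (by linarith)]
      congr 1
      rw [show s + 1 + -s = 1 by ring, Real.rpow_one]; ring
    · rw [ha, hb0, hz]; norm_num
  have hS2 : Summable fun n => ((b' n : ℝ) / a' n + a' n / b' n - 2) := by
    refine summable_lattice' _ hq (2 * (s * Real.exp s) ^ 2 + 2) _
      (fun n => hnn _ _ (pa' n) (pb' n)) (fun n hn => ?_) ?_ (by positivity)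
    · have h1 := one_le_nsqR n hn
      refine term_bound s s (nsqR n) (by linarith) (by linarith) h1 _ _ (ha' n) ?_
      rw [hb' n, mul_add, ← Real.rpow_add (by linarith)]
      congr 1
      rw [add_neg_cancel, Real.rpow_zero]; ring
    · rw [ha', hb', hz, Real.zero_rpow (by linarith)]; norm_num
  have hS : Summable fun i => (((Sum.elim b b' i : ℝ≥0) : ℝ) / (Sum.elim a a' i : ℝ≥0)
      + (Sum.elim a a' i : ℝ≥0) / (Sum.elim b b' i : ℝ≥0) - 2) := by
    exact summable_sum_type _ hS1 hS2
  refine ⟨ac_of _ _ hA hB hS μ ν hμ hν, ac_of _ _ hB hA ?_ ν μ hν hμ⟩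
  refine hS.congr fun i => ?_
  ring
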